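/- Let d be a positive integer and let G be a graph with n ≥ 5 nodes and vector-valued edge weights g_{i,j} = (g¹_{i,j},…,g^d_{i,j}) ∈ ℝ^d (and no node weights). Suppose that for every pairwise distinct i, j, k ∈ {1,…,n} and every pairwise distinct m, p, q, r ∈ {1,…,n}: g^l_{i,j} + g^l_{j,k} ≠ g^l_{m,p} + g^l_{q,r} for all l = 1,…,d, and g^l_{i,j} + g^{l+1}_{j,k} ≠ g^l_{m,p} + g^{l+1}_{q,r} for all l = 1,…,d−1. Then G is reconstructible from the following 3d−1 one-dimensional distributions: D_{g^l}(G) for l = 1,…,d; D_{α^l}(G) for l = 1,…,d; and D_{α^{l,l+1}}(G) for l = 1,…,d−1. That is, every graph G' with n nodes and edge weights in ℝ^d for which all these distributions agree with those of G is isomorphic to G. -/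

import Mathlib

/-- The multiset of (scalar) edge weights `f{i,j}` over unordered pairs
`{i,j}`, `i ≠ j`. -/
def edgeDist {n : ℕ} {X : Type*} (f : Sym2 (Fin n) → X) : Multiset X :=
  ((Finset.univ : Finset (Fin n × Fin n)).filter (fun p => p.1 < p.2)).val.map
    (fun p => f s(p.1, p.2))

/-- The multiset of mixed sums of adjacent edge weights
`f{i,j} + h{j,k}` over triples of pairwise distinct `i, j, k`.  Taking
`f = h` gives the distribution of sums of adjacent edge weights. -/
def mixAdjDist {n : ℕ} {X : Type*} [Add X] (f h : Sym2 (Fin n) → X) :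
    Multiset X :=
  ((Finset.univ : Finset (Fin n × Fin n × Fin n)).filter
      (fun p => p.1 ≠ p.2.1 ∧ p.2.1 ≠ p.2.2 ∧ p.1 ≠ p.2.2)).val.map
    (fun p => f s(p.1, p.2.1) + h s(p.2.1, p.2.2))

/-- Two graphs with edge weights and no node weights are isomorphic if there is
a permutation `π` of the nodes with `g'{i,j} = g{π i, π j}` for all `i ≠ j`. -/
def EdgeGraphIso {n : ℕ} {X : Type*} (g g' : Sym2 (Fin n) → X) : Prop :=
  ∃ π : Equiv.Perm (Fin n), ∀ i j : Fin n, i ≠ j → g' s(i, j) = g s(π i, π j)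

/-- The edges of the complete graph on `V`. -/
abbrev CompleteEdge (V : Type*) := {e : Sym2 V // ¬ e.IsDiag}

namespace CompleteEdge

variable {V : Type*}

/-- The edge joining two distinct vertices. -/
def mk (a b : V) (h : a ≠ b) : CompleteEdge V := ⟨s(a, b), by simpa using h⟩

/-- Two distinct edges sharing a vertex. -/
def Adj (e f : CompleteEdge V) : Prop := e ≠ f ∧ ∃ v, v ∈ e.1 ∧ v ∈ f.1

lemma exists_eq_mk (e : CompleteEdge V) : ∃ a b, ∃ h : a ≠ b, e = mk a b h := by
  obtain ⟨e, he⟩ := e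
  induction e using Sym2.ind with
  | _ a b => exact ⟨a, b, by simpa using he, rfl⟩

lemma exists_eq_mk_of_mem {e : CompleteEdge V} {v : V} (hv : v ∈ e.1) :
    ∃ b, ∃ h : v ≠ b, e = mk v b h := by
  obtain ⟨a, b, h, rfl⟩ := e.exists_eq_mk
  rcases Sym2.mem_iff.1 hv with rfl | rfl
  · exact ⟨b, h, rfl⟩
  · exact ⟨a, h.symm, Subtype.ext Sym2.eq_swap⟩

@[simp] lemma mem_mk {a b v : V} (h : a ≠ b) : v ∈ (mk a b h).1 ↔ v = a ∨ v = b := by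
  simp [mk]

lemma mk_eq_mk_iff {a b c d : V} (h : a ≠ b) (h' : c ≠ d) :
    mk a b h = mk c d h' ↔ a = c ∧ b = d ∨ a = d ∧ b = c := by
  simp [mk]

lemma adj_mk_mk_iff {a b c d : V} (h : a ≠ b) (h' : c ≠ d) :
    Adj (mk a b h) (mk c d h') ↔ ¬(a = c ∧ b = d ∨ a = d ∧ b = c) ∧
      (a = c ∨ a = d ∨ b = c ∨ b = d) := by
  rw [Adj, ne_eq, mk_eq_mk_iff]
  refine and_congr_right fun _ => ?_
  simp [or_and_right, exists_or, or_assoc]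

lemma mem_of_pairwise_adj {e f h k : CompleteEdge V} {w : V} (he : w ∈ e.1) (hf : w ∈ f.1)
    (hef : Adj e f) (heh : Adj e h) (hek : Adj e k) (hfh : Adj f h) (hfk : Adj f k)
    (hhk : Adj h k) : w ∈ h.1 := by
  obtain ⟨a, hwa, rfl⟩ := exists_eq_mk_of_mem he
  obtain ⟨b, hwb, rfl⟩ := exists_eq_mk_of_mem hf
  obtain ⟨c, d, hcd, rfl⟩ := h.exists_eq_mk
  obtain ⟨x, y, hxy, rfl⟩ := k.exists_eq_mk
  simp only [adj_mk_mk_iff, mem_mk] at *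
  grind

lemma exists_adj_of_ne [Fintype V] (hV : 5 ≤ Fintype.card V) {e f : CompleteEdge V}
    (hef : e ≠ f) : ∃ h, Adj h e ∧ h ≠ f ∧ ¬ Adj h f := by
  classical
  obtain ⟨a, b, hab, rfl⟩ := e.exists_eq_mk
  obtain ⟨c, d, hcd, rfl⟩ := f.exists_eq_mk
  obtain ⟨x, hx⟩ : ∃ x, x ∉ ({a, b, c, d} : Finset V) := by
    by_contra! hall
    have h₁ := Finset.card_le_card (fun v _ => hall v : Finset.univ ⊆ ({a, b, c, d} : Finset V))
    have h₂ := Finset.card_le_four (a := a) (b := b) (c := c) (d := d)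
    rw [Finset.card_univ] at h₁
    omega
  simp only [Finset.mem_insert, Finset.mem_singleton, not_or] at hx
  by_cases ha : a = c ∨ a = d
  · refine ⟨mk b x (Ne.symm hx.2.1), ?_⟩
    simp only [adj_mk_mk_iff, ne_eq, mk_eq_mk_iff] at *
    grind
  · refine ⟨mk a x (Ne.symm hx.1), ?_⟩
    simp only [adj_mk_mk_iff, ne_eq, mk_eq_mk_iff] at *
    grind

/-- A permutation of the edges of a finite complete graph that preserves adjacency also reflects
it. -/
lemma adj_iff_of_adj_imp [Finite V] {φ : Equiv.Perm (CompleteEdge V)}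
    (h : ∀ e f, Adj e f → Adj (φ e) (φ f)) (e f : CompleteEdge V) :
    Adj (φ e) (φ f) ↔ Adj e f := by
  refine ⟨fun hA => ?_, h e f⟩
  have hinj : Function.Injective
      (fun q : {q : CompleteEdge V × CompleteEdge V // Adj q.1 q.2} =>
        (⟨(φ q.1.1, φ q.1.2), h _ _ q.2⟩ :
          {q : CompleteEdge V × CompleteEdge V // Adj q.1 q.2})) := by
    rintro ⟨⟨a, b⟩, _⟩ ⟨⟨c, d⟩, _⟩ hq
    simpa only [Subtype.mk.injEq, Prod.mk.injEq, φ.injective.eq_iff] using hq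
  obtain ⟨⟨⟨a, b⟩, hab⟩, hq⟩ := Finite.surjective_of_injective hinj ⟨(φ e, φ f), hA⟩
  simp only [Subtype.mk.injEq, Prod.mk.injEq, φ.injective.eq_iff] at hq
  obtain ⟨rfl, rfl⟩ := hq
  exact hab

/-- Whitney's theorem for complete graphs on at least five vertices: every automorphism of the
line graph is induced by a permutation of the vertices. -/
theorem exists_perm_of_adj_iff [Fintype V] (hV : 5 ≤ Fintype.card V)
    {φ : Equiv.Perm (CompleteEdge V)} (hφ : ∀ e f, Adj (φ e) (φ f) ↔ Adj e f) :
    ∃ π : Equiv.Perm V, ∀ a b (h : a ≠ b), (φ (mk a b h)).1 = s(π a, π b) := by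
  classical
  have exists_new (s : Finset V) (hs : s.card ≤ 4) : ∃ x, x ∉ s := by
    by_contra! hall
    have := Finset.card_le_card (fun v _ => hall v : Finset.univ ⊆ s)
    rw [Finset.card_univ] at this
    omega
  have star : ∀ v, ∃ w, ∀ x (h : v ≠ x), w ∈ (φ (mk v x h)).1 := by
    intro v
    have key : ∀ {x y} (hx : v ≠ x) (hy : v ≠ y), x ≠ y → Adj (φ (mk v x hx)) (φ (mk v y hy)) := by
      intro x y hx hy hxy
      rw [hφ]
      simp only [adj_mk_mk_iff]
      grind
    obtain ⟨a, ha⟩ := exists_new {v} (by simp)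
    obtain ⟨b, hb⟩ := exists_new {v, a} (Finset.card_le_two.trans (by norm_num))
    simp only [Finset.mem_insert, Finset.mem_singleton, not_or] at ha hb
    have hva : v ≠ a := Ne.symm ha
    have hvb : v ≠ b := Ne.symm hb.1
    have hab : a ≠ b := Ne.symm hb.2
    obtain ⟨-, w, hwa, hwb⟩ := key hva hvb hab
    refine ⟨w, fun x hx => ?_⟩
    by_cases hxa : x = a
    · subst hxa; exact hwa
    by_cases hxb : x = b
    · subst hxb; exact hwb
    obtain ⟨y, hy⟩ := exists_new {v, a, b, x} Finset.card_le_four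
    simp only [Finset.mem_insert, Finset.mem_singleton, not_or] at hy
    have hvy : v ≠ y := Ne.symm hy.1
    exact mem_of_pairwise_adj hwa hwb (key hva hvb hab) (key hva hx (Ne.symm hxa))
      (key hva hvy (Ne.symm hy.2.1)) (key hvb hx (Ne.symm hxb)) (key hvb hvy (Ne.symm hy.2.2.1))
      (key hx hvy (Ne.symm hy.2.2.2))
  choose π hπ using star
  have hinj : Function.Injective π := by
    intro v v' hvv
    by_contra hne
    obtain ⟨a, ha⟩ := exists_new {v, v'} (Finset.card_le_two.trans (by norm_num))
    obtain ⟨b, hb⟩ := exists_new {v, v', a} (Finset.card_le_three.trans (by norm_num))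
    simp only [Finset.mem_insert, Finset.mem_singleton, not_or] at ha hb
    have hva : v ≠ a := Ne.symm ha.1
    have hvb : v' ≠ b := Ne.symm hb.2.1
    have hdis : mk v a hva ≠ mk v' b hvb ∧ ¬ Adj (mk v a hva) (mk v' b hvb) := by
      simp only [adj_mk_mk_iff, ne_eq, mk_eq_mk_iff]
      grind
    refine hdis.2 ((hφ _ _).1 ⟨φ.injective.ne hdis.1, π v, hπ v a hva, ?_⟩)
    rw [hvv]
    exact hπ v' b hvb
  refine ⟨Equiv.ofBijective π (Finite.injective_iff_bijective.1 hinj), fun a b h => ?_⟩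
  refine (Sym2.mem_and_mem_iff (hinj.ne h)).1 ⟨hπ a b h, ?_⟩
  have hswap : mk a b h = mk b a h.symm := Subtype.ext Sym2.eq_swap
  rw [hswap]
  exact hπ b a h.symm

end CompleteEdge

/-- Two families with the same multiset of values differ by a permutation of the index type. -/
lemma exists_perm_of_map_univ_eq {ι X : Type*} [Fintype ι] {f f' : ι → X}
    (h : (Finset.univ : Finset ι).val.map f' = (Finset.univ : Finset ι).val.map f) :
    ∃ φ : Equiv.Perm ι, ∀ i, f' i = f (φ i) := by
  classical
  have hcard (x : X) : Fintype.card {i // f' i = x} = Fintype.card {i // f i = x} := by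
    have hx := congrArg (Multiset.count x) h
    rw [Multiset.count_map, Multiset.count_map, ← Finset.filter_val, ← Finset.filter_val] at hx
    simpa only [Fintype.card_subtype, Finset.card_def, eq_comm (a := x)] using hx
  exact ⟨Equiv.ofFiberEquiv fun x => Fintype.equivOfCardEq (hcard x),
    fun i => (Equiv.ofFiberEquiv_map _ i).symm⟩

lemma edgeDist_eq_map_univ {n : ℕ} {X : Type*} (f : Sym2 (Fin n) → X) :
    edgeDist f = (Finset.univ : Finset (CompleteEdge (Fin n))).val.map (fun e => f e.1) := by
  have h : ((Finset.univ : Finset (Fin n × Fin n)).filter (fun p => p.1 < p.2)).val.map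
      (fun p => s(p.1, p.2)) =
      (Finset.univ : Finset (CompleteEdge (Fin n))).val.map Subtype.val := by
    refine (Multiset.Nodup.ext (Multiset.Nodup.map_on ?_ (Finset.nodup _))
      (Multiset.Nodup.map Subtype.val_injective (Finset.nodup _))).2 ?_
    · rintro ⟨a, b⟩ hab ⟨c, d⟩ hcd h
      simp at hab hcd h
      grind
    · intro e
      induction e using Sym2.ind with
      | _ a b =>
        simp
        grind
  rw [edgeDist, ← Function.comp_def f, ← Multiset.map_map, h, Multiset.map_map]
  rfl

lemma mem_mixAdjDist {n : ℕ} {X : Type*} [Add X] {f h : Sym2 (Fin n) → X} {x : X} :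
    x ∈ mixAdjDist f h ↔ ∃ e e' : CompleteEdge (Fin n), e.Adj e' ∧ f e.1 + h e'.1 = x := by
  simp only [mixAdjDist, Multiset.mem_map, Finset.mem_val, Finset.mem_filter, Finset.mem_univ,
    true_and, Prod.exists]
  constructor
  · rintro ⟨i, j, k, ⟨hij, hjk, hik⟩, rfl⟩
    refine ⟨.mk i j hij, .mk j k hjk, ?_, rfl⟩
    simp only [CompleteEdge.adj_mk_mk_iff]
    grind
  · rintro ⟨e, e', ⟨hne, v, hv, hv'⟩, rfl⟩
    obtain ⟨a, ha, rfl⟩ := CompleteEdge.exists_eq_mk_of_mem hv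
    obtain ⟨b, hb, rfl⟩ := CompleteEdge.exists_eq_mk_of_mem hv'
    refine ⟨a, v, b, ⟨ha.symm, hb, ?_⟩, ?_⟩
    · rintro rfl
      exact hne rfl
    · rw [Sym2.eq_swap]
      rfl

/-- If sums of weights of adjacent edges never coincide with sums of weights of disjoint edges,
then relabelling the edges without changing the distribution of adjacent sums sends no adjacent
pair to a disjoint pair. -/
lemma eq_or_adj_of_mixAdjDist_eq {n : ℕ} {X : Type*} [Add X] {f h f' h' : Sym2 (Fin n) → X}
    (hyp : ∀ i j k m p q r : Fin n, i ≠ j → j ≠ k → i ≠ k →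
      m ≠ p → m ≠ q → m ≠ r → p ≠ q → p ≠ r → q ≠ r →
      f s(i, j) + h s(j, k) ≠ f s(m, p) + h s(q, r))
    {φ ψ : Equiv.Perm (CompleteEdge (Fin n))}
    (hφ : ∀ e : CompleteEdge (Fin n), f' e.1 = f (φ e).1)
    (hψ : ∀ e : CompleteEdge (Fin n), h' e.1 = h (ψ e).1)
    (hD : mixAdjDist f' h' = mixAdjDist f h) {e e' : CompleteEdge (Fin n)} (he : e.Adj e') :
    φ e = ψ e' ∨ (φ e).Adj (ψ e') := by
  by_contra! hcon
  have hmem : f' e.1 + h' e'.1 ∈ mixAdjDist f h := hD ▸ mem_mixAdjDist.2 ⟨e, e', he, rfl⟩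
  rw [hφ, hψ] at hmem
  simp only [mixAdjDist, Multiset.mem_map, Finset.mem_val, Finset.mem_filter, Finset.mem_univ,
    true_and, Prod.exists] at hmem
  obtain ⟨i, j, k, ⟨hij, hjk, hik⟩, hsum⟩ := hmem
  obtain ⟨m, p, hmp, h₁⟩ := (φ e).exists_eq_mk
  obtain ⟨q, r, hqr, h₂⟩ := (ψ e').exists_eq_mk
  rw [h₁, h₂] at hcon hsum
  simp only [ne_eq, CompleteEdge.adj_mk_mk_iff, CompleteEdge.mk_eq_mk_iff] at hcon
  obtain ⟨hmq, hmr, hpq, hpr⟩ : m ≠ q ∧ m ≠ r ∧ p ≠ q ∧ p ≠ r := by tauto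
  exact hyp i j k m p q r hij hjk hik hmp hmq hmr hpq hpr hqr hsum

/-- A graph with `n ≥ 5` nodes and vector-valued edge weights in `ℝ^d`
satisfying the genericity conditions componentwise (for each component `l`, and
for each pair of consecutive components `l, l+1`) is reconstructible from the
`3d - 1` one-dimensional distributions `D_{g^l}` (`l = 1,…,d`), `D_{α^l}`
(`l = 1,…,d`) and `D_{α^{l,l+1}}` (`l = 1,…,d-1`). -/
theorem reconstructible_d_attribute {n d : ℕ} (hn : 5 ≤ n) (hd : 0 < d)
    (g : Sym2 (Fin n) → (Fin d → ℝ))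
    (hyp₁ : ∀ i j k m p q r : Fin n,
      i ≠ j → j ≠ k → i ≠ k →
      m ≠ p → m ≠ q → m ≠ r → p ≠ q → p ≠ r → q ≠ r →
      ∀ l : Fin d,
        g s(i, j) l + g s(j, k) l ≠ g s(m, p) l + g s(q, r) l)
    (hyp₂ : ∀ i j k m p q r : Fin n,
      i ≠ j → j ≠ k → i ≠ k →
      m ≠ p → m ≠ q → m ≠ r → p ≠ q → p ≠ r → q ≠ r →
      ∀ (l : Fin d) (hl : l.val + 1 < d),
        g s(i, j) l + g s(j, k) ⟨l.val + 1, hl⟩ ≠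
          g s(m, p) l + g s(q, r) ⟨l.val + 1, hl⟩) :
    ∀ g' : Sym2 (Fin n) → (Fin d → ℝ),
      (∀ l : Fin d,
        edgeDist (fun p => g' p l) = edgeDist (fun p => g p l)) →
      (∀ l : Fin d,
        mixAdjDist (fun p => g' p l) (fun p => g' p l) =
          mixAdjDist (fun p => g p l) (fun p => g p l)) →
      (∀ (l : Fin d) (hl : l.val + 1 < d),
        mixAdjDist (fun p => g' p l) (fun p => g' p ⟨l.val + 1, hl⟩) =
          mixAdjDist (fun p => g p l) (fun p => g p ⟨l.val + 1, hl⟩)) →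
      EdgeGraphIso g g' := by
  intro g' h₁ h₂ h₃
  have hV : 5 ≤ Fintype.card (Fin n) := by simpa using hn
  have hex : ∀ l : Fin d, ∃ φ : Equiv.Perm (CompleteEdge (Fin n)),
      ∀ e : CompleteEdge (Fin n), g' e.1 l = g (φ e).1 l := by
    intro l
    have h := h₁ l
    rw [edgeDist_eq_map_univ, edgeDist_eq_map_univ] at h
    exact exists_perm_of_map_univ_eq h
  choose φ hφ using hex
  have hadj (l : Fin d) : ∀ e f, (φ l e).Adj (φ l f) ↔ e.Adj f :=
    CompleteEdge.adj_iff_of_adj_imp fun e f hef =>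
      (eq_or_adj_of_mixAdjDist_eq (f := fun p => g p l) (h := fun p => g p l)
        (fun i j k m p q r a b c d' e' f' a' b' c' => hyp₁ i j k m p q r a b c d' e' f' a' b' c' l)
        (hφ l) (hφ l) (h₂ l) hef).resolve_left ((φ l).injective.ne hef.1)
  have hstep (l : Fin d) (hl : l.val + 1 < d) : φ l = φ ⟨l.val + 1, hl⟩ := by
    ext1 e
    by_contra hne
    obtain ⟨x, hx, hx₁, hx₂⟩ := CompleteEdge.exists_adj_of_ne hV hne
    have hxe : ((φ l).symm x).Adj e := by
      rw [← hadj l]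
      simpa using hx
    have := eq_or_adj_of_mixAdjDist_eq (f := fun p => g p l) (h := fun p => g p ⟨l.val + 1, hl⟩)
      (fun i j k m p q r a b c d' e' f' a' b' c' =>
        hyp₂ i j k m p q r a b c d' e' f' a' b' c' l hl)
      (hφ l) (hφ _) (h₃ l hl) hxe
    rw [Equiv.apply_symm_apply] at this
    exact this.elim hx₁ hx₂
  have hconst : ∀ (l : ℕ) (hl : l < d), φ ⟨l, hl⟩ = φ ⟨0, hd⟩ := by
    intro l
    induction l with
    | zero => intro _; rfl
    | succ l ih => intro hl; rw [← ih (by omega), hstep ⟨l, by omega⟩ hl]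
  obtain ⟨π, hπ⟩ := CompleteEdge.exists_perm_of_adj_iff hV (hadj ⟨0, hd⟩)
  refine ⟨π, fun i j hij => funext fun l => ?_⟩
  rw [← hπ i j hij, ← hconst l l.isLt]
  exact hφ l (.mk i j hij)
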